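/- arXiv:2310.18714 — 8 statements merged into one kernel-verified Lean document; each statement's English description precedes it below -/
import Mathlib

section
/- If for an update frame (E, Bel, ▽) there exists a faithful collective assignment f that represents ▽, i.e. Bel(S ▽ φ) = ⋃_{w ∈ Bel S} min(φ, f S w) for all S ∈ E and φ ⊆ W, then ▽ satisfies the modified KM postulates (U1▽)–(U8▽). -/
/-- A preorder on `W` given as a binary relation: reflexive and transitive. -/
def IsPreorderRel {W : Type*} (R : W → W → Prop) : Prop :=
  (∀ x, R x x) ∧ (∀ x y z, R x y → R y z → R x z)

/-- The strict part of a relation. -/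
def strictLt {W : Type*} (R : W → W → Prop) (x y : W) : Prop := R x y ∧ ¬ R y x

/-- The minimal elements of `N` w.r.t. the relation `R`. -/
def minSet {W : Type*} (N : Set W) (R : W → W → Prop) : Set W :=
  {x | x ∈ N ∧ ∀ y ∈ N, ¬ strictLt R y x}

/-- `R` is faithful to `w` iff `w` is strictly below every other world. -/
def FaithfulTo {W : Type*} (R : W → W → Prop) (w : W) : Prop :=
  ∀ w', w' ≠ w → strictLt R w w'

/-- The modified KM postulates (U1▽)-(U8▽) for an update frame `(E, Bel, upd)`. -/
def SatisfiesKM {W E : Type*} (Bel : E → Set W) (upd : E → Set W → E) : Prop :=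
  (∀ (S : E) (φ : Set W), Bel (upd S φ) ⊆ φ) ∧
  (∀ (S : E) (φ : Set W), Bel S ⊆ φ → Bel (upd S φ) = Bel S) ∧
  (∀ (S : E) (φ : Set W), Bel S ≠ ∅ → φ ≠ ∅ → Bel (upd S φ) ≠ ∅) ∧
  (∀ (S : E) (φ ψ : Set W), Bel (upd S φ) ∩ ψ ⊆ Bel (upd S (φ ∩ ψ))) ∧
  (∀ (S : E) (φ ψ : Set W),
    Bel (upd S φ) ⊆ ψ → Bel (upd S ψ) ⊆ φ → Bel (upd S φ) = Bel (upd S ψ)) ∧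
  (∀ (S : E) (φ ψ : Set W), (∃ w, Bel S = {w}) →
    Bel (upd S φ) ∩ Bel (upd S ψ) ⊆ Bel (upd S (φ ∪ ψ))) ∧
  (∀ (S : E) (φ : Set W), ∃ T : W → E, (∀ w ∈ Bel S, Bel (T w) = {w}) ∧
    Bel (upd S φ) = ⋃ w ∈ Bel S, Bel (upd (T w) φ))

/-- A faithful collective assignment for the frame `(E, Bel)`. -/
def FaithfulCollective {W E : Type*} (Bel : E → Set W)
    (f : E → W → (W → W → Prop)) : Prop :=
  ∀ S : E, ∀ w ∈ Bel S,
    IsPreorderRel (f S w) ∧ FaithfulTo (f S w) w ∧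
    ∃ S' : E, Bel S' = {w} ∧ f S' w = f S w

/-- The assignment `f` represents the update operator `upd`. -/
def Represents {W E : Type*} (Bel : E → Set W) (upd : E → Set W → E)
    (f : E → W → (W → W → Prop)) : Prop :=
  ∀ (S : E) (φ : Set W), Bel (upd S φ) = ⋃ w ∈ Bel S, minSet φ (f S w)

/-- A minimal element of a finite set lies below each of its members. -/
theorem IsPreorderRel.exists_mem_minSet {W : Type*} [Finite W] {R : W → W → Prop}
    (hR : IsPreorderRel R) {N : Set W} {y : W} (hy : y ∈ N) : ∃ m ∈ minSet N R, R m y := by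
  let _ : Preorder W := { le := R, le_refl := hR.1, le_trans := hR.2 }
  obtain ⟨m, hmy, hm⟩ := N.toFinite.exists_le_minimal hy
  exact ⟨m, ⟨hm.1, fun z hz hzm => hzm.2 (hm.2 hz hzm.1)⟩, hmy⟩

theorem minSet_subset {W : Type*} (N : Set W) (R : W → W → Prop) : minSet N R ⊆ N :=
  fun _ hx => hx.1

theorem FaithfulTo.minSet_eq {W : Type*} {R : W → W → Prop} {w : W} (h : FaithfulTo R w)
    {N : Set W} (hw : w ∈ N) : minSet N R = {w} := by
  ext x
  refine ⟨fun hx => by_contra fun hne => hx.2 w hw (h x hne), ?_⟩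
  rintro rfl
  refine ⟨hw, fun y _ hyx => ?_⟩
  by_cases hne : y = x
  · subst hne
    exact hyx.2 hyx.1
  · exact hyx.2 (h y hne).1

theorem minSet_inter_subset {W : Type*} (N M : Set W) (R : W → W → Prop) :
    minSet N R ∩ M ⊆ minSet (N ∩ M) R :=
  fun _ hx => ⟨⟨hx.1.1, hx.2⟩, fun y hy => hx.1.2 y hy.1⟩

theorem minSet_inter_minSet_subset {W : Type*} (N M : Set W) (R : W → W → Prop) :
    minSet N R ∩ minSet M R ⊆ minSet (N ∪ M) R :=
  fun _ hx => ⟨Or.inl hx.1.1, fun y hy => hy.elim (hx.1.2 y) (hx.2.2 y)⟩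

theorem IsPreorderRel.minSet_subset_minSet {W : Type*} [Finite W] {R : W → W → Prop}
    (hR : IsPreorderRel R) {N M : Set W} (hNM : minSet N R ⊆ M) (hMN : minSet M R ⊆ N) :
    minSet N R ⊆ minSet M R := by
  refine fun x hx => ⟨hNM hx, fun y hy hyx => ?_⟩
  obtain ⟨m, hm, hmy⟩ := hR.exists_mem_minSet hy
  exact hx.2 m (hMN hm) ⟨hR.2 _ _ _ hmy hyx.1, fun hxm => hyx.2 (hR.2 _ _ _ hxm hmy)⟩

theorem representation_implies_km {W E : Type*} [Fintype W] (Bel : E → Set W) (upd : E → Set W → E)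
    (f : E → W → (W → W → Prop))
    (hf : FaithfulCollective Bel f) (hrep : Represents Bel upd f) :
    SatisfiesKM Bel upd := by
  refine ⟨fun S φ => ?_, fun S φ h => ?_, fun S φ hS hφ => ?_, fun S φ ψ => ?_,
    fun S φ ψ h₁ h₂ => ?_, fun S φ ψ ⟨w, hw⟩ => ?_, fun S φ => ?_⟩
  · rw [hrep]
    exact Set.iUnion₂_subset fun w _ => minSet_subset φ _
  · rw [hrep, Set.iUnion₂_congr fun w hw => (hf S w hw).2.1.minSet_eq (h hw)]
    exact Set.biUnion_of_singleton _
  · obtain ⟨w, hw⟩ := Set.nonempty_iff_ne_empty.mpr hS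
    obtain ⟨y, hy⟩ := Set.nonempty_iff_ne_empty.mpr hφ
    obtain ⟨m, hm, -⟩ := (hf S w hw).1.exists_mem_minSet hy
    rw [hrep, ← Set.nonempty_iff_ne_empty]
    exact ⟨m, Set.mem_biUnion hw hm⟩
  · rw [hrep, hrep, Set.iUnion₂_inter]
    exact Set.iUnion₂_mono fun w _ => minSet_inter_subset φ ψ _
  · rw [hrep, Set.iUnion₂_subset_iff] at h₁ h₂
    rw [hrep, hrep]
    exact Set.iUnion₂_congr fun w hw => Set.Subset.antisymm
      ((hf S w hw).1.minSet_subset_minSet (h₁ w hw) (h₂ w hw))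
      ((hf S w hw).1.minSet_subset_minSet (h₂ w hw) (h₁ w hw))
  · simp only [hrep S, hw, Set.biUnion_singleton]
    exact minSet_inter_minSet_subset φ ψ _
  · have key : ∀ w, ∃ S' : E, w ∈ Bel S → Bel S' = {w} ∧ f S' w = f S w := fun w => by
      by_cases hw : w ∈ Bel S
      · exact (hf S w hw).2.2.imp fun _ h _ => h
      · exact ⟨S, fun h => absurd h hw⟩
    choose T hT using key
    refine ⟨T, fun w hw => (hT w hw).1, ?_⟩
    rw [hrep]
    refine Set.iUnion₂_congr fun w hw => ?_
    rw [hrep, (hT w hw).1, Set.biUnion_singleton, (hT w hw).2]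
end

section
/- The concrete update operator ▽₁ on the frame E₁ satisfies postulate (C3▽): for all states (B, r) ∈ E₁ and all φ, ψ ⊆ W, if Bel((B, r) ▽₁ ψ) ⊆ φ then Bel(((B, r) ▽₁ φ) ▽₁ ψ) ⊆ φ. -/
/-- A belief state of the concrete frame `E₁`: a belief set `B` together with an
assignment `r` of a preorder to each world, faithful to `w` whenever `w ∈ B`. -/
structure State1 (W : Type*) where
  B : Set W
  r : W → (W → W → Prop)
  pre : ∀ w, IsPreorderRel (r w)
  faith : ∀ w ∈ B, FaithfulTo (r w) w

open Classical in
/-- The level of a world in the three-tier hierarchy determined by `w'` and `φ`. -/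
noncomputable def levelOf {W : Type*} (w' : W) (φ : Set W) (x : W) : ℕ :=
  if x = w' then 0 else if x ∈ φ then 1 else 2

/-- The three-tier hierarchy preorder `H(w', φ)`. -/
def hier {W : Type*} (w' : W) (φ : Set W) : W → W → Prop :=
  fun x y => levelOf w' φ x ≤ levelOf w' φ y

theorem hier_pre {W : Type*} (w' : W) (φ : Set W) : IsPreorderRel (hier w' φ) :=
  ⟨fun _ => le_refl _, fun _ _ _ h1 h2 => le_trans h1 h2⟩

theorem hier_faithful {W : Type*} (w' : W) (φ : Set W) :
    FaithfulTo (hier w' φ) w' := by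
  intro x hx
  have h0 : levelOf w' φ w' = 0 := by simp [levelOf]
  have h1 : 0 < levelOf w' φ x := by
    unfold levelOf
    split
    · exact absurd ‹x = w'› hx
    · split <;> omega
  constructor
  · show levelOf w' φ w' ≤ levelOf w' φ x
    rw [h0]; exact Nat.zero_le _
  · show ¬ levelOf w' φ x ≤ levelOf w' φ w'
    rw [h0]; omega

/-- The concrete update operator `▽₁`. -/
noncomputable def upd1 {W : Type*} (S : State1 W) (φ : Set W) : State1 W where
  B := ⋃ w ∈ S.B, minSet φ (S.r w)
  r := fun w' => hier w' φ
  pre := fun w' => hier_pre w' φ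
  faith := fun w' _ => hier_faithful w' φ

theorem minSet_nonempty {W : Type*} [Finite W] {R : W → W → Prop} (hR : IsPreorderRel R)
    {N : Set W} (hN : N.Nonempty) : (minSet N R).Nonempty := by
  have : IsTrans W (strictLt R) :=
    ⟨fun a b c hab hbc => ⟨hR.2 a b c hab.1 hbc.1, fun hca => hbc.2 (hR.2 c a b hca hab.1)⟩⟩
  have : Std.Irrefl (strictLt R) := ⟨fun _ h => h.2 h.1⟩
  obtain ⟨m, hm, hmin⟩ := (Finite.wellFounded_of_trans_of_irrefl (strictLt R)).has_min N hN
  exact ⟨m, hm, hmin⟩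

theorem strictLt_hier_of_mem_of_notMem {W : Type*} {w x y : W} {φ : Set W}
    (hw : w ∈ φ) (hy : y ∈ φ) (hx : x ∉ φ) : strictLt (hier w φ) y x := by
  have hxw : x ≠ w := fun e => hx (e ▸ hw)
  by_cases hyw : y = w <;> simp [strictLt, hier, levelOf, hx, hy, hxw, hyw]

theorem upd1_satisfies_C3 {W : Type*} [Fintype W] (S : State1 W) (φ ψ : Set W)
    (h : (upd1 S ψ).B ⊆ φ) : (upd1 (upd1 S φ) ψ).B ⊆ φ := by
  intro x hx
  simp only [upd1, Set.mem_iUnion, exists_prop] at hx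
  obtain ⟨w, ⟨v, hv, hw⟩, hxψ, hmin⟩ := hx
  by_contra hxφ
  obtain ⟨y, hy⟩ := minSet_nonempty (S.pre v) ⟨x, hxψ⟩
  have hyφ : y ∈ φ := h (Set.mem_biUnion hv hy)
  exact hmin y hy.1 (strictLt_hier_of_mem_of_notMem hw.1 hyφ hxφ)
end

section
/- The concrete update operator ▽₁ on the frame E₁ satisfies postulate (C4▽): for all states (B, r) ∈ E₁ and all φ, ψ ⊆ W, if Bel((B, r) ▽₁ ψ) ∩ φ ≠ ∅ then Bel(((B, r) ▽₁ φ) ▽₁ ψ) ∩ φ ≠ ∅. -/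
theorem mem_minSet_hier_self {W : Type*} {w : W} {φ ψ : Set W} (hw : w ∈ ψ) :
    w ∈ minSet ψ (hier w φ) :=
  ⟨hw, fun _ _ hy => hy.2 (by simp [hier, levelOf])⟩

theorem mem_minSet_hier_of_notMem {W : Type*} {w x : W} {φ ψ : Set W} (hw : w ∉ ψ)
    (hxψ : x ∈ ψ) (hxφ : x ∈ φ) : x ∈ minSet ψ (hier w φ) := by
  refine ⟨hxψ, fun y hy hlt => hlt.2 ?_⟩
  have hxw : x ≠ w := fun h => hw (h ▸ hxψ)
  have hyw : y ≠ w := fun h => hw (h ▸ hy)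
  simp only [hier, levelOf, hxw, hyw, hxφ, if_true, if_false]
  split <;> omega

theorem mem_upd1_B {W : Type*} {S : State1 W} {φ : Set W} {x : W} :
    x ∈ (upd1 S φ).B ↔ ∃ w ∈ S.B, x ∈ minSet φ (S.r w) := by
  simp [upd1]

theorem upd1_satisfies_C4 {W : Type*} [Fintype W] (S : State1 W) (φ ψ : Set W)
    (h : (upd1 S ψ).B ∩ φ ≠ ∅) : (upd1 (upd1 S φ) ψ).B ∩ φ ≠ ∅ := by
  rw [← Set.nonempty_iff_ne_empty] at h ⊢
  obtain ⟨x, hxB, hxφ⟩ := h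
  obtain ⟨w, hw, hx⟩ := mem_upd1_B.1 hxB
  obtain ⟨m, hm⟩ := minSet_nonempty (S.pre w) ⟨x, hxφ⟩
  have hmB : m ∈ (upd1 S φ).B := mem_upd1_B.2 ⟨w, hw, hm⟩
  by_cases hmψ : m ∈ ψ
  · exact ⟨m, mem_upd1_B.2 ⟨m, hmB, mem_minSet_hier_self hmψ⟩, hm.1⟩
  · exact ⟨x, mem_upd1_B.2 ⟨m, hmB, mem_minSet_hier_of_notMem hmψ hx.1 hxφ⟩, hxφ⟩
end

section
/- Let W = Fin 8 with distinct elements w₁, …, w₈, and let R₁, R₂ be the specified linear preorders faithful to w₁ and w₂ respectively. For every update frame (E, Bel, ▽) over W and every faithful collective assignment f that represents ▽, if there exists a state S₀ ∈ E with Bel S₀ = {w₁, w₂}, f S₀ w₁ = R₁ and f S₀ w₂ = R₂, then ▽ does not satisfy postulate (C1▽). (Hence no update operator satisfies (U1▽)–(U8▽) together with (C1▽) on a frame containing such a state.) -/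
/-- Postulate (C1▽). -/
def PostC1 {W E : Type*} (Bel : E → Set W) (upd : E → Set W → E) : Prop :=
  ∀ (S : E) (φ ψ : Set W), ψ ⊆ φ → Bel (upd (upd S φ) ψ) = Bel (upd S ψ)

/-- The rank of each world in the list `w₁, w₂, w₃, w₄, w₆, w₅, w₇, w₈`
(worlds `w₁, …, w₈` are `0, …, 7 : Fin 8`). -/
def rank1 : Fin 8 → ℕ := ![0, 1, 2, 3, 5, 4, 6, 7]

/-- The rank of each world in the list `w₂, w₁, w₃, w₅, w₆, w₄, w₇, w₈`. -/
def rank2 : Fin 8 → ℕ := ![1, 0, 2, 5, 3, 4, 6, 7]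

/-- The linear preorder determined by the list `w₁, w₂, w₃, w₄, w₆, w₅, w₇, w₈`. -/
def Rel1 : Fin 8 → Fin 8 → Prop := fun x y => rank1 x ≤ rank1 y

/-- The linear preorder determined by the list `w₂, w₁, w₃, w₅, w₆, w₄, w₇, w₈`. -/
def Rel2 : Fin 8 → Fin 8 → Prop := fun x y => rank2 x ≤ rank2 y

/-- Membership in the result of updating a state with a single belief. -/
theorem Represents.mem_upd_of_singleton {W E : Type*} {Bel : E → Set W} {upd : E → Set W → E}
    {f : E → W → (W → W → Prop)} (hrep : Represents Bel upd f) {S : E} {w : W}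
    (hS : Bel S = {w}) (φ : Set W) (x : W) :
    x ∈ Bel (upd S φ) ↔ x ∈ minSet φ (f S w) := by
  simp [hrep S φ, hS]

/-- Membership in the result of updating a state with two beliefs. -/
theorem Represents.mem_upd_of_pair {W E : Type*} {Bel : E → Set W} {upd : E → Set W → E}
    {f : E → W → (W → W → Prop)} (hrep : Represents Bel upd f) {S : E} {v w : W}
    (hS : Bel S = {v, w}) (φ : Set W) (x : W) :
    x ∈ Bel (upd S φ) ↔ x ∈ minSet φ (f S v) ∨ x ∈ minSet φ (f S w) := by
  simp [hrep S φ, hS]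

/-- An element minimal in each of two sets is minimal in any set they cover together. -/
theorem mem_minSet_of_subset_union {W : Type*} {R : W → W → Prop} {M N P : Set W} {x : W}
    (hM : x ∈ minSet M R) (hN : x ∈ minSet N R) (hx : x ∈ P) (hP : P ⊆ M ∪ N) :
    x ∈ minSet P R :=
  ⟨hx, fun y hy => (hP hy).elim (hM.2 y) (hN.2 y)⟩

theorem no_operator_C1 {E : Type*} (Bel : E → Set (Fin 8)) (upd : E → Set (Fin 8) → E)
    (f : E → Fin 8 → (Fin 8 → Fin 8 → Prop))
    (hf : FaithfulCollective Bel f) (hrep : Represents Bel upd f)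
    (S₀ : E) (hB : Bel S₀ = {(0 : Fin 8), (1 : Fin 8)})
    (h1 : f S₀ 0 = Rel1) (h2 : f S₀ 1 = Rel2) :
    ¬ PostC1 Bel upd := by
  intro hC
  have hS : Bel (upd S₀ {2, 3, 4, 5}) = {2} := by
    ext x
    rw [hrep.mem_upd_of_pair hB, h1, h2]
    fin_cases x <;> simp [minSet, strictLt, Rel1, Rel2, rank1, rank2]
  have key (ψ : Set (Fin 8)) (hψ : ψ ⊆ {2, 3, 4, 5}) :
      5 ∈ minSet ψ (f (upd S₀ {2, 3, 4, 5}) 2) ↔ 5 ∈ minSet ψ Rel1 ∨ 5 ∈ minSet ψ Rel2 := by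
    rw [← hrep.mem_upd_of_singleton hS, hC _ _ _ hψ, hrep.mem_upd_of_pair hB, h1, h2]
  have h35 := (key {3, 5} (by simp [Set.insert_subset_iff])).2
    (by simp [minSet, strictLt, Rel1, Rel2, rank1, rank2])
  have h45 := (key {4, 5} (by simp [Set.insert_subset_iff])).2
    (by simp [minSet, strictLt, Rel1, Rel2, rank1, rank2])
  have h345 := (key {3, 4, 5} (by simp)).1
    (mem_minSet_of_subset_union h35 h45 (by simp) (by simp [Set.insert_subset_iff]))
  simp [minSet, strictLt, Rel1, Rel2, rank1, rank2] at h345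
end

section
/- Let W = Fin 8 with distinct elements w₁, …, w₈, and let R₁, R₂ be the specified linear preorders faithful to w₁ and w₂ respectively. For every update frame (E, Bel, ▽) over W and every faithful collective assignment f that represents ▽, if there exists a state S₀ ∈ E with Bel S₀ = {w₁, w₂}, f S₀ w₁ = R₁ and f S₀ w₂ = R₂, then ▽ does not satisfy postulate (C2▽). (Hence no update operator satisfies (U1▽)–(U8▽) together with (C2▽) on a frame containing such a state.) -/
/-- Postulate (C2▽). -/
def PostC2 {W E : Type*} (Bel : E → Set W) (upd : E → Set W → E) : Prop :=
  ∀ (S : E) (φ ψ : Set W), ψ ∩ φ = ∅ → Bel (upd (upd S φ) ψ) = Bel (upd S ψ)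

theorem minSet_singleton {W : Type*} (R : W → W → Prop) (x : W) : minSet {x} R = {x} := by
  ext y
  simp only [minSet, strictLt, Set.mem_ofPred_eq, Set.mem_singleton_iff]
  constructor
  · exact fun h => h.1
  · rintro rfl
    exact ⟨rfl, by rintro z rfl ⟨h, h'⟩; exact h' h⟩

theorem no_operator_C2 {E : Type*} (Bel : E → Set (Fin 8)) (upd : E → Set (Fin 8) → E)
    (f : E → Fin 8 → (Fin 8 → Fin 8 → Prop))
    (hf : FaithfulCollective Bel f) (hrep : Represents Bel upd f)
    (S₀ : E) (hB : Bel S₀ = {(0 : Fin 8), (1 : Fin 8)})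
    (h1 : f S₀ 0 = Rel1) (h2 : f S₀ 1 = Rel2) :
    ¬ PostC2 Bel upd := by
  intro hC2
  have hpair : ∀ φ, Bel (upd S₀ φ) = minSet φ Rel1 ∪ minSet φ Rel2 := by
    intro φ
    rw [hrep, hB, Set.biUnion_insert, Set.biUnion_singleton, h1, h2]
  have hBel : Bel (upd S₀ {2}) = {2} := by
    rw [hpair, minSet_singleton, minSet_singleton, Set.union_self]
  -- The single preorder at the world `2` must reproduce the joint minima of `Rel1` and `Rel2`.
  have hmin : ∀ ψ : Set (Fin 8), 2 ∉ ψ →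
      minSet ψ (f (upd S₀ {2}) 2) = minSet ψ Rel1 ∪ minSet ψ Rel2 := by
    intro ψ hψ
    rw [← hpair, ← hC2 S₀ {2} ψ (Set.inter_singleton_eq_empty.mpr hψ), hrep (upd S₀ {2}), hBel,
      Set.biUnion_singleton]
  have h35 : (5 : Fin 8) ∈ minSet {3, 5} (f (upd S₀ {2}) 2) := by
    rw [hmin _ (by simp)]
    right
    simp [minSet, strictLt, Rel2, rank2]
  have h45 : (5 : Fin 8) ∈ minSet {4, 5} (f (upd S₀ {2}) 2) := by
    rw [hmin _ (by simp)]
    left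
    simp [minSet, strictLt, Rel1, rank1]
  have h345 : (5 : Fin 8) ∉ minSet {3, 4, 5} (f (upd S₀ {2}) 2) := by
    rw [hmin _ (by simp)]
    simp [minSet, strictLt, Rel1, Rel2, rank1, rank2]
  refine h345 ⟨by simp, ?_⟩
  rintro y (rfl | rfl | rfl)
  · exact h35.2 _ (by simp)
  · exact h45.2 _ (by simp)
  · exact h35.2 _ (by simp)
end

section
/- Let (E, Bel, ▽) be an update frame whose operator ▽ satisfies the modified KM postulates (U1▽)–(U8▽). If ▽ satisfies postulate (Ind▽), then ▽ satisfies postulate (C3▽). -/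
/-- Postulate (Ind▽). -/
def PostInd {W E : Type*} (Bel : E → Set W) (upd : E → Set W → E) : Prop :=
  ∀ (S : E) (φ ψ : Set W), Bel (upd S ψ) ∩ φ ≠ ∅ → Bel (upd (upd S φ) ψ) ⊆ φ

/-- Postulate (C3▽). -/
def PostC3 {W E : Type*} (Bel : E → Set W) (upd : E → Set W → E) : Prop :=
  ∀ (S : E) (φ ψ : Set W), Bel (upd S ψ) ⊆ φ → Bel (upd (upd S φ) ψ) ⊆ φ

theorem ind_implies_c3 {W E : Type*} [Fintype W] (Bel : E → Set W) (upd : E → Set W → E)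
    (hKM : SatisfiesKM Bel upd) (h : PostInd Bel upd) :
    PostC3 Bel upd := by
  obtain ⟨subset_input, eq_of_subset, nonempty, -⟩ := hKM
  intro S φ ψ hφ
  by_cases hψ : Bel (upd S ψ) = ∅
  · by_cases hS : Bel S = ∅
    · have hSφ : Bel (upd S φ) = ∅ := by
        rw [eq_of_subset S φ (by simp [hS]), hS]
      rw [eq_of_subset (upd S φ) ψ (by simp [hSφ]), hSφ]
      exact Set.empty_subset φ
    · have hψ_empty : ψ = ∅ := by
        by_contra hne
        exact nonempty S ψ hS hne hψ
      subst hψ_empty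
      exact (subset_input _ _).trans (Set.empty_subset φ)
  · apply h
    rwa [Set.inter_eq_left.mpr hφ]
end

section
/- Let (E, Bel, ▽) be an update frame whose operator ▽ satisfies the modified KM postulates (U1▽)–(U8▽). If ▽ satisfies postulate (Ind▽), then ▽ satisfies postulate (C4▽). -/
/-- Postulate (C4▽). -/
def PostC4 {W E : Type*} (Bel : E → Set W) (upd : E → Set W → E) : Prop :=
  ∀ (S : E) (φ ψ : Set W), Bel (upd S ψ) ∩ φ ≠ ∅ → Bel (upd (upd S φ) ψ) ∩ φ ≠ ∅

theorem ind_implies_c4 {W E : Type*} [Fintype W] (Bel : E → Set W) (upd : E → Set W → E)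
    (hKM : SatisfiesKM Bel upd) (h : PostInd Bel upd) :
    PostC4 Bel upd := by
  obtain ⟨h1, h2, h3, -⟩ := hKM
  intro S φ ψ hne
  rw [Set.inter_eq_left.mpr (h S φ ψ hne)]
  have hS : Bel S ≠ ∅ := by
    intro h0
    apply hne
    rw [h2 S ψ (h0 ▸ Set.empty_subset ψ), h0, Set.empty_inter]
  have hφ : φ ≠ ∅ := by
    rintro rfl
    exact hne (Set.inter_empty _)
  have hψ : ψ ≠ ∅ := by
    rintro rfl
    apply hne
    rw [Set.subset_empty_iff.mp (h1 S ∅), Set.empty_inter]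
  exact h3 _ ψ (h3 S φ hS hφ) hψ
end

section
/- The concrete update operator ▽₁ on the frame E₁ satisfies postulate (Ind▽): for all states (B, r) ∈ E₁ and all φ, ψ ⊆ W, if Bel((B, r) ▽₁ ψ) ∩ φ ≠ ∅ then Bel(((B, r) ▽₁ φ) ▽₁ ψ) ⊆ φ. -/
theorem upd1_B_subset {W : Type*} (S : State1 W) (φ : Set W) : (upd1 S φ).B ⊆ φ :=
  Set.iUnion₂_subset fun w _ => minSet_subset φ (S.r w)

theorem levelOf_le_one {W : Type*} (w : W) {φ : Set W} {x : W} (hx : x ∈ φ) :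
    levelOf w φ x ≤ 1 := by
  unfold levelOf
  split_ifs <;> simp

theorem levelOf_eq_two {W : Type*} {w : W} {φ : Set W} {x : W} (hw : w ∈ φ) (hx : x ∉ φ) :
    levelOf w φ x = 2 := by
  have hne : x ≠ w := fun h => hx (h ▸ hw)
  simp [levelOf, hne, hx]

theorem minSet_hier_subset {W : Type*} {w : W} {φ ψ : Set W} (hw : w ∈ φ)
    (h : (ψ ∩ φ).Nonempty) : minSet ψ (hier w φ) ⊆ φ := by
  obtain ⟨z, hzψ, hzφ⟩ := h
  intro x hx
  by_contra hxφ
  have hz := levelOf_le_one w hzφ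
  have hx2 := levelOf_eq_two hw hxφ
  refine hx.2 z hzψ ⟨?_, ?_⟩ <;> unfold hier <;> omega

theorem upd1_satisfies_Ind {W : Type*} [Fintype W] (S : State1 W) (φ ψ : Set W)
    (h : (upd1 S ψ).B ∩ φ ≠ ∅) : (upd1 (upd1 S φ) ψ).B ⊆ φ := by
  have hne : (ψ ∩ φ).Nonempty :=
    (Set.nonempty_iff_ne_empty.mpr h).mono (Set.inter_subset_inter_left φ (upd1_B_subset S ψ))
  exact Set.iUnion₂_subset fun w hw => minSet_hier_subset (upd1_B_subset S φ hw) hne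
end
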